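/- There exist constants C, c > 0 such that for all integers b, n, m, x ≥ 1 and for i ∈ {0,1}, P_i( 𝔇_{β_{n+m}} − 𝔇_{β_n} ≥ b + x ) ≤ C e^{−cx} · P_i( 𝔇_{β_{n+m}} − 𝔇_{β_n} ≥ b ); equivalently, the conditional probability P_i( 𝔇_{β_{n+m}} − 𝔇_{β_n} ≥ b+x | 𝔇_{β_{n+m}} − 𝔇_{β_n} ≥ b ) is at most C e^{−cx}. -/

import Mathlib

open MeasureTheory Filter ProbabilityTheory

noncomputable section

/-- One-step transition probability of the urn discrepancy chain with parameter `lam`: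
from state `i`, jump to `i+1` with probability `lam^(2i-1)/(1+lam^(2i-1))` and to `i-1`
with probability `1/(1+lam^(2i-1))`. -/
def urnStep (lam : ℝ) (i j : ℤ) : ℝ :=
  if j = i + 1 then lam ^ (2 * i - 1) / (1 + lam ^ (2 * i - 1))
  else if j = i - 1 then 1 / (1 + lam ^ (2 * i - 1))
  else 0

/-- `P` is the family of laws (indexed by the starting point) of the urn discrepancy
chain with parameter `lam`, characterized by its cylinder probabilities. -/
def IsUrnChain (lam : ℝ) (P : ℤ → Measure (ℕ → ℤ)) : Prop :=
  (∀ x, IsProbabilityMeasure (P x)) ∧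
    ∀ (x : ℤ) (n : ℕ) (p : ℕ → ℤ),
      (P x {ω | ∀ i ≤ n, ω i = p i}).toReal =
        (if p 0 = x then (1 : ℝ) else 0) *
          ∏ i ∈ Finset.range n, urnStep lam (p i) (p (i + 1))

/-- Number of down-steps of the path `ω` during the time interval `[1, j]`. -/
def downCount (ω : ℕ → ℤ) (j : ℕ) : ℕ :=
  ((Finset.Icc 1 j).filter fun ℓ => ω ℓ = ω (ℓ - 1) - 1).card

/-- `betaTime ω i` is the time of the `i`-th down-step of the path `ω`. -/
def betaTime (ω : ℕ → ℤ) (i : ℕ) : ℕ :=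
  sInf {j | 1 ≤ j ∧ downCount ω j = i}

/-- The probability distribution `π(x) = lam^(x²) / Σ_y lam^(y²)` on `ℤ`. -/
def urnPi (lam : ℝ) (x : ℤ) : ℝ :=
  lam ^ (x ^ 2) / ∑' y : ℤ, lam ^ (y ^ 2)

/-- Probability of an up-step of the urn discrepancy chain from state `z`. -/
def upProb (lam : ℝ) (z : ℤ) : ℝ := lam ^ (2 * z - 1) / (1 + lam ^ (2 * z - 1))

/-- Probability that `U` up-steps occur before `l` down-steps (in particular `1` when `U = 0`),
for the chain started at `w + l - U`; equivalently, that the chain is at or above `w` at the time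
of its `l`-th down-step. -/
def raceProb (lam : ℝ) (w : ℤ) : ℕ → ℕ → ℝ
  | _, 0 => 1
  | 0, _ + 1 => 0
  | l + 1, U + 1 =>
    upProb lam (w + l - U) * raceProb lam w (l + 1) U +
      (1 - upProb lam (w + l - U)) * raceProb lam w l (U + 1)
termination_by l U => l + U

section Transition

variable {lam : ℝ}

lemma upProb_pos (h0 : 0 < lam) (z : ℤ) : 0 < upProb lam z := by
  unfold upProb
  positivity

lemma one_sub_upProb (h0 : 0 < lam) (z : ℤ) :
    1 - upProb lam z = 1 / (1 + lam ^ (2 * z - 1)) := by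
  have : (0 : ℝ) < lam ^ (2 * z - 1) := by positivity
  unfold upProb
  field_simp
  ring

lemma one_sub_upProb_pos (h0 : 0 < lam) (z : ℤ) : 0 < 1 - upProb lam z := by
  rw [one_sub_upProb h0]
  positivity

lemma zpow_two_mul_add_one_sub_one (h0 : 0 < lam) (z : ℤ) :
    lam ^ (2 * (z + 1) - 1) = lam ^ 2 * lam ^ (2 * z - 1) := by
  rw [show 2 * (z + 1) - 1 = 2 + (2 * z - 1) by ring, zpow_add₀ h0.ne']
  norm_cast

lemma upProb_succ_le (h0 : 0 < lam) (h1 : lam < 1) (z : ℤ) :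
    upProb lam (z + 1) ≤ upProb lam z := by
  have ht : (0 : ℝ) < lam ^ (2 * z - 1) := by positivity
  unfold upProb
  rw [zpow_two_mul_add_one_sub_one h0]
  rw [div_le_div_iff₀ (by positivity) (by positivity)]
  nlinarith [mul_pos h0 ht]

lemma upProb_succ_le_mul (h0 : 0 < lam) (h1 : lam < 1) {z : ℤ} (hz : 0 ≤ z) :
    upProb lam (z + 1) ≤ lam * upProb lam z := by
  have ht : (0 : ℝ) < lam ^ (2 * z - 1) := by positivity
  have ht' : lam * lam ^ (2 * z - 1) ≤ 1 := by
    rw [← zpow_one_add₀ h0.ne', show 1 + (2 * z - 1) = 2 * z by ring]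
    exact zpow_le_one₀ h0 h1.le (by omega)
  unfold upProb
  rw [zpow_two_mul_add_one_sub_one h0]
  generalize lam ^ (2 * z - 1) = t at *
  rw [← mul_div_assoc, div_le_div_iff₀ (by positivity) (by positivity)]
  have : 0 ≤ lam * t * ((1 - lam) * (1 - lam * t)) :=
    mul_nonneg (by positivity) (mul_nonneg (by linarith) (by linarith))
  nlinarith

lemma upProb_le_half (h0 : 0 < lam) (h1 : lam < 1) {z : ℤ} (hz : 1 ≤ z) :
    upProb lam z ≤ 1 / 2 := by
  have ht : (0 : ℝ) < lam ^ (2 * z - 1) := by positivity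
  have ht' : lam ^ (2 * z - 1) ≤ 1 := zpow_le_one₀ h0 h1.le (by omega)
  unfold upProb
  rw [div_le_div_iff₀ (by positivity) (by positivity)]
  linarith

lemma upProb_reflect (h0 : 0 < lam) (z : ℤ) : upProb lam (1 - z) = 1 - upProb lam z := by
  have ht : (0 : ℝ) < lam ^ (2 * z - 1) := by positivity
  rw [one_sub_upProb h0]
  unfold upProb
  rw [show 2 * (1 - z) - 1 = -(2 * z - 1) by ring, zpow_neg]
  field_simp
  ring

end Transition

section Race

variable {lam : ℝ}

lemma raceProb_zero_right (w : ℤ) (l : ℕ) : raceProb lam w l 0 = 1 := by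
  simp [raceProb]

lemma raceProb_zero_left (w : ℤ) (U : ℕ) : raceProb lam w 0 (U + 1) = 0 := by
  simp [raceProb]

lemma raceProb_succ_succ (w : ℤ) (l U : ℕ) :
    raceProb lam w (l + 1) (U + 1) =
      upProb lam (w + l - U) * raceProb lam w (l + 1) U +
        (1 - upProb lam (w + l - U)) * raceProb lam w l (U + 1) := by
  rw [raceProb]

lemma raceProb_mem_Icc (h0 : 0 < lam) (w : ℤ) (l U : ℕ) :
    raceProb lam w l U ∈ Set.Icc (0 : ℝ) 1 := by
  induction U generalizing l with
  | zero => simp [raceProb_zero_right]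
  | succ U ihU =>
    induction l with
    | zero => simp [raceProb_zero_left]
    | succ l ihl =>
      rw [raceProb_succ_succ]
      exact convex_Icc (0 : ℝ) 1 (ihU (l + 1)) ihl (upProb_pos h0 _).le
        (one_sub_upProb_pos h0 _).le (by ring)

lemma raceProb_diag_le (h0 : 0 < lam) (w : ℤ) (N l U : ℕ) (hN : l + U = N) :
    raceProb lam w l (U + 1) ≤ raceProb lam w (l + 1) U := by
  induction N using Nat.strong_induction_on generalizing l U with
  | _ N ih =>
    rcases U with _ | U
    · rw [raceProb_zero_right]
      exact (raceProb_mem_Icc h0 _ _ _).2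
    rcases l with _ | l
    · rw [raceProb_zero_left]
      exact (raceProb_mem_Icc h0 _ _ _).1
    trans raceProb lam w (l + 1) (U + 1)
    · have := ih (l + (U + 1)) (by omega) l (U + 1) rfl
      rw [raceProb_succ_succ (U := U + 1)]
      nlinarith [one_sub_upProb_pos h0 (w + l - (U + 1 : ℕ))]
    · have := ih (l + 1 + U) (by omega) (l + 1) U rfl
      rw [raceProb_succ_succ (l := l + 1)]
      nlinarith [upProb_pos h0 (w + (l + 1 : ℕ) - U)]

lemma raceProb_succ_right_le (h0 : 0 < lam) (w : ℤ) (l U : ℕ) :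
    raceProb lam w l (U + 1) ≤ raceProb lam w l U := by
  rcases l with _ | l
  · rw [raceProb_zero_left]
    exact (raceProb_mem_Icc h0 _ _ _).1
  · have := raceProb_diag_le h0 w _ l U rfl
    rw [raceProb_succ_succ]
    nlinarith [one_sub_upProb_pos h0 (w + l - U)]

lemma raceProb_le_succ_left (h0 : 0 < lam) (w : ℤ) (l U : ℕ) :
    raceProb lam w l U ≤ raceProb lam w (l + 1) U := by
  rcases U with _ | U
  · simp [raceProb_zero_right]
  · have := raceProb_diag_le h0 w _ l U rfl
    rw [raceProb_succ_succ]
    nlinarith [upProb_pos h0 (w + l - U)]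

/-- A comparison of the races at levels `w + 1` and `w` needs to be checked for a single up-step
only. -/
lemma raceProb_level_succ_le_of_one (h0 : 0 < lam) (h1 : lam < 1) {w : ℤ} {r : ℝ} (hr : 0 ≤ r)
    (hone : ∀ l, raceProb lam (w + 1) l 1 ≤ r * raceProb lam w l 1) (l U : ℕ) :
    raceProb lam (w + 1) l (U + 1) ≤ r * raceProb lam w l (U + 1) := by
  induction U generalizing l with
  | zero => exact hone l
  | succ U ihU =>
    induction l with
    | zero => simp [raceProb_zero_left]
    | succ l ihl =>
      rw [raceProb_succ_succ (w + 1) l (U + 1), raceProb_succ_succ w l (U + 1),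
        show w + 1 + (l : ℤ) - (U + 1 : ℕ) = w + l - (U + 1 : ℕ) + 1 by ring]
      have hU := ihU (l + 1)
      have hd := mul_le_mul_of_nonneg_left (raceProb_diag_le h0 w _ l (U + 1) rfl) hr
      have ha := upProb_succ_le h0 h1 (w + l - (U + 1 : ℕ))
      have hp := upProb_pos h0 (w + l - (U + 1 : ℕ) + 1)
      have hq := one_sub_upProb_pos h0 (w + l - (U + 1 : ℕ) + 1)
      generalize upProb lam (w + l - (U + 1 : ℕ) + 1) = p' at *
      generalize upProb lam (w + l - (U + 1 : ℕ)) = p at *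
      have e1 := mul_le_mul_of_nonneg_left hU hp.le
      have e2 := mul_le_mul_of_nonneg_left ihl hq.le
      have e3 := mul_le_mul_of_nonneg_left hd (sub_nonneg.2 ha)
      nlinarith

lemma raceProb_one (w : ℤ) (l : ℕ) :
    raceProb lam w l 1 = 1 - ∏ i ∈ Finset.range l, (1 - upProb lam (w + i)) := by
  induction l with
  | zero => simp [raceProb_zero_left]
  | succ l ih =>
    rw [raceProb_succ_succ, raceProb_zero_right, ih, Finset.prod_range_succ]
    simp only [Nat.cast_zero, sub_zero]
    ring

lemma raceProb_level_succ_le (h0 : 0 < lam) (h1 : lam < 1) (w : ℤ) (l U : ℕ) :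
    raceProb lam (w + 1) l U ≤ raceProb lam w l U := by
  rcases U with _ | U
  · simp [raceProb_zero_right]
  · have := raceProb_level_succ_le_of_one h0 h1 (w := w) zero_le_one (fun l => ?_) l U
    · simpa using this
    rw [raceProb_one, raceProb_one, one_mul]
    refine sub_le_sub_left (Finset.prod_le_prod (fun i _ => (one_sub_upProb_pos h0 _).le)
      fun i _ => ?_) _
    rw [add_right_comm]
    linarith [upProb_succ_le h0 h1 (w + i)]

lemma exp_le_prod_one_sub_upProb (h0 : 0 < lam) (h1 : lam < 1) {w : ℤ} (hw : 0 ≤ w) (l : ℕ) :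
    Real.exp (-(lam⁻¹ / (1 - lam))) ≤ ∏ i ∈ Finset.range l, (1 - upProb lam (w + i)) := by
  have hfac : ∀ i : ℕ, Real.exp (-(lam⁻¹ * lam ^ i)) ≤ 1 - upProb lam (w + i) := by
    intro i
    have hle : lam ^ (2 * (w + i) - 1) ≤ lam⁻¹ * lam ^ i := by
      rw [← zpow_natCast, ← zpow_neg_one, ← zpow_add₀ h0.ne']
      exact zpow_le_zpow_right_of_le_one₀ h0 h1.le (by omega)
    rw [one_sub_upProb h0, Real.exp_neg, ← one_div]
    refine one_div_le_one_div_of_le (by positivity) ?_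
    linarith [Real.add_one_le_exp (lam⁻¹ * lam ^ i)]
  refine le_trans ?_ (Finset.prod_le_prod (fun i _ => (Real.exp_pos _).le) fun i _ => hfac i)
  rw [← Real.exp_sum, Real.exp_le_exp, Finset.sum_neg_distrib, neg_le_neg_iff, ← Finset.mul_sum,
    div_eq_mul_inv]
  refine mul_le_mul_of_nonneg_left ?_ (by positivity)
  rw [← tsum_geometric_of_lt_one h0.le h1]
  exact (summable_geometric_of_lt_one h0.le h1).sum_le_tsum _ fun i _ => by positivity

/-- If `a i ≤ r * b i` then, up to a constant, `1 - ∏ (1 - a i)` is smaller than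
`1 - ∏ (1 - b i)` by a fixed factor. -/
lemma mul_one_sub_prod_le_prod_sub_prod {a b : ℕ → ℝ} {r δ : ℝ} (hr : 0 < r) (hr1 : r ≤ 1)
    (ha : ∀ i, 0 ≤ a i) (ha1 : ∀ i, a i ≤ 1) (hab : ∀ i, a i ≤ r * b i)
    (hδ : ∀ l, δ ≤ ∏ i ∈ Finset.range l, (1 - b i)) (hδ0 : 0 ≤ δ) (l : ℕ) :
    δ * (r⁻¹ - 1) * (1 - ∏ i ∈ Finset.range l, (1 - a i)) ≤
      ∏ i ∈ Finset.range l, (1 - a i) - ∏ i ∈ Finset.range l, (1 - b i) := by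
  induction l with
  | zero => simp
  | succ l ih =>
    rw [Finset.prod_range_succ, Finset.prod_range_succ]
    have hδl := hδ l
    generalize ∏ i ∈ Finset.range l, (1 - a i) = A at *
    generalize ∏ i ∈ Finset.range l, (1 - b i) = B at *
    have hba : (r⁻¹ - 1) * a l ≤ b l - a l := by
      have : r⁻¹ * a l ≤ b l := by
        rw [inv_mul_le_iff₀ hr]
        exact hab l
      linarith
    have hpos : 0 ≤ (r⁻¹ - 1) * a l :=
      mul_nonneg (sub_nonneg.2 (one_le_inv_iff₀.2 ⟨hr, hr1⟩)) (ha l)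
    have e1 := mul_le_mul_of_nonneg_left ih (sub_nonneg.2 (ha1 l))
    have e2 := mul_le_mul hba hδl hδ0 (hpos.trans hba)
    nlinarith

/-- The factor gained when the race is shifted up by one level. -/
def raceRatio (lam : ℝ) : ℝ :=
  (1 + Real.exp (-(lam⁻¹ / (1 - lam))) * (lam⁻¹ - 1))⁻¹

lemma raceRatio_mem_Ioo (h0 : 0 < lam) (h1 : lam < 1) :
    raceRatio lam ∈ Set.Ioo (0 : ℝ) 1 := by
  have : 0 < Real.exp (-(lam⁻¹ / (1 - lam))) * (lam⁻¹ - 1) :=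
    mul_pos (Real.exp_pos _) (sub_pos.2 ((one_lt_inv₀ h0).2 h1))
  exact ⟨by unfold raceRatio; positivity, inv_lt_one_of_one_lt₀ (by linarith)⟩

lemma raceProb_level_succ_le_ratio (h0 : 0 < lam) (h1 : lam < 1) {w : ℤ} (hw : 0 ≤ w)
    (l U : ℕ) :
    raceProb lam (w + 1) l (U + 1) ≤ raceRatio lam * raceProb lam w l (U + 1) := by
  refine raceProb_level_succ_le_of_one h0 h1 (raceRatio_mem_Ioo h0 h1).1.le (fun l => ?_) l U
  have hkey := mul_one_sub_prod_le_prod_sub_prod (a := fun i => upProb lam (w + 1 + i))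
    (b := fun i => upProb lam (w + i)) h0 h1.le (fun i => (upProb_pos h0 _).le)
    (fun i => (sub_pos.1 (one_sub_upProb_pos h0 _)).le)
    (fun i => by
      rw [add_right_comm]
      exact upProb_succ_le_mul h0 h1 (by positivity))
    (exp_le_prod_one_sub_upProb h0 h1 hw) (Real.exp_pos _).le l
  have hpos := inv_pos.1 (raceRatio_mem_Ioo h0 h1).1
  rw [raceProb_one, raceProb_one, raceRatio, le_inv_mul_iff₀ hpos]
  linarith

lemma raceProb_level_add_le (h0 : 0 < lam) (h1 : lam < 1) {w : ℤ} (hw : 0 ≤ w) (l U k : ℕ) :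
    raceProb lam (w + k) l (U + 1 + k) ≤ raceRatio lam ^ k * raceProb lam w l (U + 1) := by
  induction k with
  | zero => simp
  | succ k ih =>
    calc raceProb lam (w + (k + 1 : ℕ)) l (U + 1 + (k + 1))
        ≤ raceProb lam (w + k + 1) l (U + k + 1) := by
          rw [show w + ((k + 1 : ℕ) : ℤ) = w + k + 1 by push_cast; ring,
            show U + 1 + (k + 1) = U + k + 1 + 1 by ring]
          exact raceProb_succ_right_le h0 _ _ _
      _ ≤ raceRatio lam * raceProb lam (w + k) l (U + k + 1) :=
          raceProb_level_succ_le_ratio h0 h1 (by positivity) _ _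
      _ ≤ raceRatio lam * (raceRatio lam ^ k * raceProb lam w l (U + 1)) := by
          refine mul_le_mul_of_nonneg_left ?_ (raceRatio_mem_Ioo h0 h1).1.le
          rwa [add_right_comm U k 1]
      _ = _ := by ring

lemma raceProb_level_add_le_self (h0 : 0 < lam) (h1 : lam < 1) (w : ℤ) (l U k : ℕ) :
    raceProb lam (w + k) l (U + k) ≤ raceProb lam w l U := by
  induction k with
  | zero => simp
  | succ k ih =>
    rw [show w + ((k + 1 : ℕ) : ℤ) = w + k + 1 by push_cast; ring]
    exact ((raceProb_succ_right_le h0 _ l (U + k)).trans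
      (raceProb_level_succ_le h0 h1 (w + k) l (U + k))).trans ih

/-- Reflection: either `U` up-steps come before `l` down-steps, or the other way round. -/
lemma raceProb_add_reflect (h0 : 0 < lam) (w : ℤ) (l U : ℕ) (h : l + U ≠ 0) :
    raceProb lam w l U + raceProb lam (1 - w) U l = 1 := by
  induction U generalizing l with
  | zero =>
    obtain ⟨l, rfl⟩ := Nat.exists_eq_succ_of_ne_zero (show l ≠ 0 by omega)
    simp [raceProb_zero_right, raceProb_zero_left]
  | succ U ihU =>
    induction l with
    | zero => simp [raceProb_zero_right, raceProb_zero_left]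
    | succ l ihl =>
      have e1 := ihU (l + 1) (by omega)
      have e2 := ihl (by omega)
      rw [raceProb_succ_succ, raceProb_succ_succ,
        show (1 : ℤ) - w + U - l = 1 - (w + l - U) by ring, upProb_reflect h0]
      linear_combination upProb lam (w + l - U) * e1 + (1 - upProb lam (w + l - U)) * e2

lemma one_sub_ratio_le_raceProb (h0 : 0 < lam) (h1 : lam < 1) {w : ℤ} (hw : w ≤ 0) (l U : ℕ) :
    1 - raceRatio lam ≤ raceProb lam w (l + 1) U := by
  have e := raceProb_add_reflect h0 w (l + 1) U (by omega)
  have := raceProb_level_succ_le_ratio h0 h1 (neg_nonneg.2 hw) U l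
  rw [neg_add_eq_sub] at this
  nlinarith [(raceRatio_mem_Ioo h0 h1).1, (raceProb_mem_Icc h0 (-w) U (l + 1)).2]

end Race

section MaximumPrinciple

variable {lam : ℝ}

/-- Minimum principle for the first-step recursion at down-step times. -/
lemma nonneg_of_firstStep (h0 : 0 < lam) (h1 : lam < 1) {Ψ : ℕ → ℤ → ℝ} {M : ℝ}
    (hM : ∀ n z, -M ≤ Ψ n z)
    (hrec : ∀ n z, Ψ (n + 1) z =
      upProb lam z * Ψ (n + 1) (z + 1) + (1 - upProb lam z) * Ψ n (z - 1))
    (hzero : ∀ z, 0 ≤ Ψ 0 z) (n : ℕ) (z : ℤ) : 0 ≤ Ψ n z := by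
  induction n generalizing z with
  | zero => exact hzero z
  | succ n ih =>
    have hstep : ∀ z, upProb lam z * Ψ (n + 1) (z + 1) ≤ Ψ (n + 1) z := fun z => by
      rw [hrec n z]
      linarith [mul_nonneg (one_sub_upProb_pos h0 z).le (ih (z - 1))]
    have hgeom : ∀ (k : ℕ) (z : ℤ), 1 ≤ z → -(|M| * (1 / 2) ^ k) ≤ Ψ (n + 1) z := by
      intro k
      induction k with
      | zero => intro z _; linarith [hM (n + 1) z, le_abs_self M]
      | succ k ihk =>
        intro z hz
        refine le_trans ?_ (hstep z)
        have e := ihk (z + 1) (by omega)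
        have hp := upProb_le_half h0 h1 hz
        have hM0 : 0 ≤ |M| * (1 / 2 : ℝ) ^ k := by positivity
        rw [pow_succ]
        nlinarith [mul_le_mul_of_nonneg_left e (upProb_pos h0 z).le,
          mul_le_mul_of_nonneg_right hp hM0]
    have hpos : ∀ z : ℤ, 1 ≤ z → 0 ≤ Ψ (n + 1) z := by
      intro z hz
      have hlim : Tendsto (fun k : ℕ => -(|M| * (1 / 2 : ℝ) ^ k)) atTop (nhds (-(|M| * 0))) :=
        ((tendsto_pow_atTop_nhds_zero_of_lt_one (by norm_num) (by norm_num)).const_mul _).neg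
      simpa using le_of_tendsto' hlim fun k => hgeom k z hz
    have hdown : ∀ (k : ℕ) (z : ℤ), 1 - (k : ℤ) ≤ z → 0 ≤ Ψ (n + 1) z := by
      intro k
      induction k with
      | zero => intro z hz; exact hpos z (by simpa using hz)
      | succ k ihk =>
        intro z hz
        exact (mul_nonneg (upProb_pos h0 z).le (ihk (z + 1) (by push_cast at hz; omega))).trans
          (hstep z)
    exact hdown (1 - z).toNat z (by omega)

/-- Bounded solutions of the first-step recursion are determined by their initial values. -/
lemma eq_of_firstStep (h0 : 0 < lam) (h1 : lam < 1) {Φ Ψ : ℕ → ℤ → ℝ}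
    (hΦ : ∀ n z, Φ n z ∈ Set.Icc (0 : ℝ) 1) (hΨ : ∀ n z, Ψ n z ∈ Set.Icc (0 : ℝ) 1)
    (hΦrec : ∀ n z, Φ (n + 1) z =
      upProb lam z * Φ (n + 1) (z + 1) + (1 - upProb lam z) * Φ n (z - 1))
    (hΨrec : ∀ n z, Ψ (n + 1) z =
      upProb lam z * Ψ (n + 1) (z + 1) + (1 - upProb lam z) * Ψ n (z - 1))
    (hzero : ∀ z, Φ 0 z = Ψ 0 z) (n : ℕ) (z : ℤ) : Φ n z = Ψ n z := by
  apply le_antisymm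
  · refine sub_nonneg.1 (nonneg_of_firstStep (Ψ := fun n z => Ψ n z - Φ n z) (M := 1) h0 h1
      (fun n z => ?_) (fun n z => ?_) (fun z => (sub_nonneg.2 (hzero z).le)) n z)
    · linarith [(hΦ n z).2, (hΨ n z).1]
    · rw [hΦrec, hΨrec]; ring
  · refine sub_nonneg.1 (nonneg_of_firstStep (Ψ := fun n z => Φ n z - Ψ n z) (M := 1) h0 h1
      (fun n z => ?_) (fun n z => ?_) (fun z => (sub_nonneg.2 (hzero z).ge)) n z)
    · linarith [(hΦ n z).1, (hΨ n z).2]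
    · rw [hΦrec, hΨrec]; ring

/-- The probability of being at or above `w` at the `n`-th down-step, as a function of the
starting point `z`, is a solution of the first-step recursion. -/
lemma raceProb_firstStep (w : ℤ) (n : ℕ) (z : ℤ) :
    raceProb lam w (n + 1) (w + (n + 1 : ℕ) - z).toNat =
      upProb lam z * raceProb lam w (n + 1) (w + (n + 1 : ℕ) - (z + 1)).toNat +
        (1 - upProb lam z) * raceProb lam w n (w + n - (z - 1)).toNat := by
  push_cast
  rcases le_or_gt (w + (n + 1) - z) 0 with h | h
  · rw [Int.toNat_of_nonpos h, Int.toNat_of_nonpos (by omega), Int.toNat_of_nonpos (by omega)]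
    simp [raceProb_zero_right]
  · obtain ⟨U, hU⟩ := Int.eq_ofNat_of_zero_le (show 0 ≤ w + n - z by omega)
    rw [show w + (n + 1) - z = ((U + 1 : ℕ) : ℤ) by push_cast; omega,
      show w + (n + 1) - (z + 1) = (U : ℤ) by omega,
      show w + n - (z - 1) = ((U + 1 : ℕ) : ℤ) by push_cast; omega, Int.toNat_natCast,
      Int.toNat_natCast, raceProb_succ_succ, show w + n - (U : ℤ) = z by omega]

end MaximumPrinciple

section Cylinder

/-- The cylinder of paths that agree with `p` up to time `n`. -/
def pathCylinder (p : ℕ → ℤ) (n : ℕ) : Set (ℕ → ℤ) := {ω | ∀ i ≤ n, ω i = p i}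

lemma measurableSet_pathCylinder (p : ℕ → ℤ) (n : ℕ) : MeasurableSet (pathCylinder p n) := by
  have : pathCylinder p n = ⋂ i, ⋂ _ : i ≤ n, (fun ω : ℕ → ℤ => ω i) ⁻¹' {p i} := by
    ext ω
    simp [pathCylinder]
  rw [this]
  exact MeasurableSet.iInter fun i => MeasurableSet.iInter fun _ =>
    measurable_pi_apply i (measurableSet_singleton _)

lemma generateFrom_pathCylinder :
    (MeasurableSpace.pi : MeasurableSpace (ℕ → ℤ)) =
      MeasurableSpace.generateFrom {s | ∃ p n, s = pathCylinder p n} := by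
  apply le_antisymm
  · refine iSup_le fun n => ?_
    rw [← measurable_iff_comap_le]
    refine @measurable_to_countable' ℤ (ℕ → ℤ) _ _ (MeasurableSpace.generateFrom _) _ fun a => ?_
    have : (fun ω : ℕ → ℤ => ω n) ⁻¹' {a} =
        ⋃ q : {q : Fin (n + 1) → ℤ // q (Fin.last n) = a},
          pathCylinder (fun i => if h : i < n + 1 then q.1 ⟨i, h⟩ else 0) n := by
      ext ω
      simp only [Set.mem_preimage, Set.mem_singleton_iff, Set.mem_iUnion, pathCylinder,
        Set.mem_ofPred_eq]
      constructor
      · intro h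
        refine ⟨⟨fun i => ω i, h⟩, fun i hi => ?_⟩
        simp [Nat.lt_succ_of_le hi]
      · rintro ⟨⟨q, hq⟩, h⟩
        rw [h n le_rfl, dif_pos (Nat.lt_succ_self n)]
        exact hq
    rw [this]
    exact MeasurableSet.iUnion fun q => MeasurableSpace.measurableSet_generateFrom ⟨_, _, rfl⟩
  · refine MeasurableSpace.generateFrom_le ?_
    rintro _ ⟨p, n, rfl⟩
    exact measurableSet_pathCylinder p n

lemma isPiSystem_pathCylinder : IsPiSystem {s | ∃ p n, s = pathCylinder p n} := by
  rintro _ ⟨p, n, rfl⟩ _ ⟨q, k, rfl⟩ ⟨ω, hp, hq⟩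
  refine ⟨ω, max n k, ?_⟩
  ext ω'
  constructor
  · rintro ⟨h, h'⟩ i hi
    rcases le_max_iff.1 hi with hi | hi
    · rw [h i hi, hp i hi]
    · rw [h' i hi, hq i hi]
  · intro h
    exact ⟨fun i hi => (h i (le_max_of_le_left hi)).trans (hp i hi),
      fun i hi => (h i (le_max_of_le_right hi)).trans (hq i hi)⟩

/-- The path that starts at `x` and then follows `ω`. -/
def consPath (x : ℤ) (ω : ℕ → ℤ) : ℕ → ℤ
  | 0 => x
  | n + 1 => ω n

lemma measurable_consPath (x : ℤ) : Measurable (consPath x) := by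
  refine measurable_pi_lambda _ fun n => ?_
  cases n with
  | zero => exact measurable_const
  | succ n => exact measurable_pi_apply n

lemma consPath_preimage_pathCylinder_zero (x : ℤ) (p : ℕ → ℤ) :
    consPath x ⁻¹' pathCylinder p 0 = if p 0 = x then Set.univ else ∅ := by
  ext ω
  split_ifs with h <;> simp [pathCylinder, consPath, h, eq_comm]

lemma consPath_preimage_pathCylinder_succ (x : ℤ) (p : ℕ → ℤ) (n : ℕ) :
    consPath x ⁻¹' pathCylinder p (n + 1) =
      if p 0 = x then pathCylinder (fun i => p (i + 1)) n else ∅ := by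
  ext ω
  split_ifs with h
  · refine ⟨fun hω i hi => hω (i + 1) (by omega), fun hω i hi => ?_⟩
    cases i with
    | zero => exact h.symm
    | succ i => exact hω i (by omega)
  · simp only [Set.mem_empty_iff_false, iff_false]
    exact fun hω => h (hω 0 (by omega)).symm

end Cylinder

section FirstStep

variable {lam : ℝ} {P : ℤ → Measure (ℕ → ℤ)}

lemma urnStep_eq (h0 : 0 < lam) (i j : ℤ) :
    urnStep lam i j = upProb lam i * (if j = i + 1 then 1 else 0) +
      (1 - upProb lam i) * (if j = i - 1 then 1 else 0) := by
  rw [one_sub_upProb h0]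
  unfold urnStep upProb
  by_cases h : j = i + 1
  · simp [h, show i + 1 ≠ i - 1 by omega]
  · simp [h]

lemma IsUrnChain.real_pathCylinder (hP : IsUrnChain lam P) (x : ℤ) (p : ℕ → ℤ) (n : ℕ) :
    (P x).real (pathCylinder p n) = (if p 0 = x then (1 : ℝ) else 0) *
      ∏ i ∈ Finset.range n, urnStep lam (p i) (p (i + 1)) :=
  hP.2 x n p

/-- First-step decomposition of the law of the chain. -/
lemma IsUrnChain.real_firstStep (h0 : 0 < lam) (hP : IsUrnChain lam P) (x : ℤ)
    {A : Set (ℕ → ℤ)} (hA : MeasurableSet A) :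
    (P x).real A = upProb lam x * (P (x + 1)).real (consPath x ⁻¹' A) +
      (1 - upProb lam x) * (P (x - 1)).real (consPath x ⁻¹' A) := by
  have := hP.1
  have hu := (upProb_pos h0 x).le
  have hd := (one_sub_upProb_pos h0 x).le
  set ν : Measure (ℕ → ℤ) :=
    ENNReal.ofReal (upProb lam x) • (P (x + 1)).map (consPath x) +
      ENNReal.ofReal (1 - upProb lam x) • (P (x - 1)).map (consPath x) with hν
  have hfin : ∀ y, IsFiniteMeasure ((P y).map (consPath x)) := fun y => inferInstance
  have hν_real : ∀ {B : Set (ℕ → ℤ)}, MeasurableSet B →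
      ν.real B = upProb lam x * (P (x + 1)).real (consPath x ⁻¹' B) +
        (1 - upProb lam x) * (P (x - 1)).real (consPath x ⁻¹' B) := by
    intro B hB
    simp only [hν, Measure.real, Measure.add_apply, Measure.smul_apply, smul_eq_mul,
      Measure.map_apply (measurable_consPath x) hB]
    rw [ENNReal.toReal_add (by finiteness) (by finiteness), ENNReal.toReal_mul,
      ENNReal.toReal_mul, ENNReal.toReal_ofReal hu, ENNReal.toReal_ofReal hd]
  have hνfin : IsFiniteMeasure ν := ⟨by
    simp only [hν, Measure.add_apply, Measure.smul_apply, smul_eq_mul]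
    finiteness⟩
  have heq : P x = ν := by
    refine ext_of_generate_finite _ generateFrom_pathCylinder isPiSystem_pathCylinder ?_ ?_
    · rintro _ ⟨p, n, rfl⟩
      rw [← measureReal_eq_measureReal_iff, hν_real (measurableSet_pathCylinder p n),
        hP.real_pathCylinder]
      cases n with
      | zero =>
        rw [consPath_preimage_pathCylinder_zero]
        split_ifs <;> simp
      | succ n =>
        rw [consPath_preimage_pathCylinder_succ]
        split_ifs with h
        · rw [hP.real_pathCylinder, hP.real_pathCylinder, Finset.prod_range_succ', urnStep_eq h0,
            zero_add, h]
          ring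
        · simp
    · rw [← measureReal_eq_measureReal_iff, hν_real MeasurableSet.univ]
      simp
  rw [← hν_real hA, ← heq]

lemma IsUrnChain.ae_start (hP : IsUrnChain lam P) (x : ℤ) : ∀ᵐ ω ∂P x, ω 0 = x := by
  have := hP.1 x
  have h := hP.real_pathCylinder x (fun _ => x) 0
  simp only [if_true, Finset.range_zero, Finset.prod_empty, mul_one] at h
  have hae : ∀ᵐ ω ∂P x, ω ∈ pathCylinder (fun _ => x) 0 :=
    (mem_ae_iff_prob_eq_one (measurableSet_pathCylinder _ _)).2 ((ENNReal.toReal_eq_one_iff _).1 h)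
  filter_upwards [hae] with ω hω using hω 0 le_rfl

end FirstStep

section DownSteps

lemma downCount_zero (ω : ℕ → ℤ) : downCount ω 0 = 0 := by
  simp [downCount]

lemma downCount_succ (ω : ℕ → ℤ) (j : ℕ) :
    downCount ω (j + 1) = downCount ω j + if ω (j + 1) = ω j - 1 then 1 else 0 := by
  simp only [downCount, Finset.card_filter]
  rw [Finset.sum_Icc_succ_top (by omega), Nat.add_sub_cancel]

lemma downCount_consPath (x : ℤ) (ω : ℕ → ℤ) (j : ℕ) :
    downCount (consPath x ω) (j + 1) = downCount ω j + if ω 0 = x - 1 then 1 else 0 := by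
  induction j with
  | zero => rw [downCount_succ, downCount_zero, downCount_zero]; rfl
  | succ j ih => rw [downCount_succ, ih, downCount_succ, add_right_comm]; rfl

/-- The time of the `n`-th down-step of `ω`, with value `0` for `n = 0`. -/
def downTime (ω : ℕ → ℤ) (n : ℕ) : ℕ := sInf {j | downCount ω j = n}

/-- The position of `ω` at its `n`-th down-step, with value `ω 0` for `n = 0`. -/
def downPos (ω : ℕ → ℤ) (n : ℕ) : ℤ := ω (downTime ω n)

/-- `ω` has at least `n` down-steps. -/
def HasDownSteps (ω : ℕ → ℤ) (n : ℕ) : Prop := ∃ j, downCount ω j = n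

lemma betaTime_eq_downTime (ω : ℕ → ℤ) {n : ℕ} (hn : 1 ≤ n) : betaTime ω n = downTime ω n := by
  unfold betaTime downTime
  congr 1
  ext j
  refine ⟨fun h => h.2, fun h => ⟨Nat.one_le_iff_ne_zero.2 ?_, h⟩⟩
  rintro rfl
  have : downCount ω 0 = n := h
  rw [downCount_zero] at this
  omega

lemma downTime_zero (ω : ℕ → ℤ) : downTime ω 0 = 0 :=
  Nat.sInf_eq_zero.2 (Or.inl (downCount_zero ω))

lemma downPos_zero (ω : ℕ → ℤ) : downPos ω 0 = ω 0 := by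
  rw [downPos, downTime_zero]

lemma hasDownSteps_zero (ω : ℕ → ℤ) : HasDownSteps ω 0 := ⟨0, downCount_zero ω⟩

lemma hasDownSteps_succ_iff (ω : ℕ → ℤ) (n : ℕ) :
    HasDownSteps ω (n + 1) ↔ ∃ j, downCount ω (j + 1) = n + 1 := by
  constructor
  · rintro ⟨_ | j, h⟩
    · rw [downCount_zero] at h
      omega
    · exact ⟨j, h⟩
  · rintro ⟨j, h⟩
    exact ⟨j + 1, h⟩

lemma downTime_succ_eq (ω : ℕ → ℤ) {n : ℕ} (h : HasDownSteps ω (n + 1)) :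
    downTime ω (n + 1) = sInf {j | downCount ω (j + 1) = n + 1} + 1 := by
  refine (Nat.sInf_add (n := 1) (p := fun j => downCount ω j = n + 1) ?_).symm
  refine le_csInf h fun j hj => Nat.one_le_iff_ne_zero.2 ?_
  rintro rfl
  have : downCount ω 0 = n + 1 := hj
  rw [downCount_zero] at this
  omega

lemma hasDownSteps_consPath_up {x : ℤ} {ω : ℕ → ℤ} (hω : ω 0 = x + 1) (n : ℕ) :
    HasDownSteps (consPath x ω) (n + 1) ↔ HasDownSteps ω (n + 1) := by
  rw [hasDownSteps_succ_iff]
  simp [downCount_consPath, hω, HasDownSteps, show x + 1 ≠ x - 1 by omega]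

lemma hasDownSteps_consPath_down {x : ℤ} {ω : ℕ → ℤ} (hω : ω 0 = x - 1) (n : ℕ) :
    HasDownSteps (consPath x ω) (n + 1) ↔ HasDownSteps ω n := by
  rw [hasDownSteps_succ_iff]
  simp [downCount_consPath, hω, HasDownSteps]

lemma downPos_consPath_up {x : ℤ} {ω : ℕ → ℤ} (hω : ω 0 = x + 1) {n : ℕ}
    (h : HasDownSteps ω (n + 1)) : downPos (consPath x ω) (n + 1) = downPos ω (n + 1) := by
  rw [downPos, downTime_succ_eq _ ((hasDownSteps_consPath_up hω n).2 h)]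
  simp [downCount_consPath, hω, show x + 1 ≠ x - 1 by omega, consPath, downPos, downTime]

lemma downPos_consPath_down {x : ℤ} {ω : ℕ → ℤ} (hω : ω 0 = x - 1) {n : ℕ}
    (h : HasDownSteps ω n) : downPos (consPath x ω) (n + 1) = downPos ω n := by
  rw [downPos, downTime_succ_eq _ ((hasDownSteps_consPath_down hω n).2 h)]
  simp [downCount_consPath, hω, consPath, downPos, downTime]

lemma measurable_downCount (j : ℕ) : Measurable fun ω : ℕ → ℤ => downCount ω j := by
  induction j with
  | zero => simpa only [downCount_zero] using measurable_const
  | succ j ih =>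
    simp only [downCount_succ]
    refine ih.add (Measurable.ite ?_ measurable_const measurable_const)
    exact measurableSet_eq_fun (measurable_pi_apply _) ((measurable_pi_apply _).sub_const 1)

lemma measurableSet_downCount_eq (j n : ℕ) : MeasurableSet {ω : ℕ → ℤ | downCount ω j = n} :=
  measurable_downCount j (measurableSet_singleton n)

lemma measurableSet_hasDownSteps (n : ℕ) : MeasurableSet {ω : ℕ → ℤ | HasDownSteps ω n} := by
  simp only [HasDownSteps, Set.ofPred_exists]
  exact MeasurableSet.iUnion fun j => measurableSet_downCount_eq j n

lemma downTime_eq_iff (ω : ℕ → ℤ) (n t : ℕ) :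
    downTime ω n = t ↔ (downCount ω t = n ∧ ∀ s < t, downCount ω s ≠ n) ∨
      (t = 0 ∧ ¬HasDownSteps ω n) := by
  by_cases h : HasDownSteps ω n
  · have hmem : downCount ω (downTime ω n) = n := Nat.sInf_mem h
    simp only [h, not_true_eq_false, and_false, or_false]
    constructor
    · rintro rfl
      exact ⟨hmem, fun s hs => Nat.notMem_of_lt_sInf (s := {j | downCount ω j = n}) hs⟩
    · rintro ⟨ht, hlt⟩
      refine le_antisymm (Nat.sInf_le ht) (not_lt.1 fun hs => hlt _ hs hmem)
  · have h0 : downTime ω n = 0 :=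
      Nat.sInf_eq_zero.2 (Or.inr (Set.eq_empty_of_forall_notMem fun j hj => h ⟨j, hj⟩))
    rw [h0]
    constructor
    · rintro rfl
      exact Or.inr ⟨rfl, h⟩
    · rintro (⟨ht, _⟩ | ⟨rfl, _⟩)
      · exact absurd ⟨t, ht⟩ h
      · rfl

lemma measurable_downTime (n : ℕ) : Measurable fun ω : ℕ → ℤ => downTime ω n := by
  refine measurable_to_countable' fun t => ?_
  have : (fun ω : ℕ → ℤ => downTime ω n) ⁻¹' {t} =
      ({ω | downCount ω t = n} ∩ ⋂ s, ⋂ _ : s < t, {ω | downCount ω s = n}ᶜ) ∪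
        ({_ω | t = 0} ∩ {ω | HasDownSteps ω n}ᶜ) := by
    ext ω
    simp [downTime_eq_iff]
  rw [this]
  exact ((measurableSet_downCount_eq t n).inter (MeasurableSet.iInter fun s =>
    MeasurableSet.iInter fun _ => (measurableSet_downCount_eq s n).compl)).union
    ((MeasurableSet.const _).inter (measurableSet_hasDownSteps n).compl)

lemma measurable_downPos (n : ℕ) : Measurable fun ω : ℕ → ℤ => downPos ω n := by
  have : Measurable fun q : (ℕ → ℤ) × ℕ => q.1 q.2 :=
    measurable_from_prod_countable_left fun t => measurable_pi_apply t
  exact this.comp (measurable_id.prodMk (measurable_downTime n))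

end DownSteps

section ChainAtDownSteps

variable {lam : ℝ} {P : ℤ → Measure (ℕ → ℤ)}

/-- First-step recursion for an event that is unaffected by deleting the first step of the path,
up to counting down-steps. -/
lemma IsUrnChain.real_firstStep_of_consPath (h0 : 0 < lam) (hP : IsUrnChain lam P)
    {A : ℕ → Set (ℕ → ℤ)} (hA : ∀ n, MeasurableSet (A n))
    (hup : ∀ n x, ∀ᵐ ω ∂P (x + 1), ω 0 = x + 1 → (consPath x ω ∈ A (n + 1) ↔ ω ∈ A (n + 1)))
    (hdown : ∀ n x, ∀ᵐ ω ∂P (x - 1), ω 0 = x - 1 → (consPath x ω ∈ A (n + 1) ↔ ω ∈ A n))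
    (n : ℕ) (x : ℤ) :
    (P x).real (A (n + 1)) = upProb lam x * (P (x + 1)).real (A (n + 1)) +
      (1 - upProb lam x) * (P (x - 1)).real (A n) := by
  rw [hP.real_firstStep h0 x (hA (n + 1))]
  congr 2
  · refine measureReal_congr ?_
    filter_upwards [hP.ae_start (x + 1), hup n x] with ω hω h using propext (h hω)
  · refine measureReal_congr ?_
    filter_upwards [hP.ae_start (x - 1), hdown n x] with ω hω h using propext (h hω)

lemma IsUrnChain.ae_hasDownSteps (h0 : 0 < lam) (h1 : lam < 1) (hP : IsUrnChain lam P) (n : ℕ)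
    (x : ℤ) : ∀ᵐ ω ∂P x, HasDownSteps ω n := by
  have := hP.1
  refine (mem_ae_iff_prob_eq_one (measurableSet_hasDownSteps n)).2
    ((ENNReal.toReal_eq_one_iff _).1 ?_)
  refine eq_of_firstStep h0 h1 (Φ := fun n x => (P x).real {ω | HasDownSteps ω n})
    (Ψ := fun _ _ => 1) (fun n x => ⟨measureReal_nonneg, measureReal_le_one⟩)
    (fun _ _ => ⟨zero_le_one, le_rfl⟩) ?_ (fun n z => by ring) (fun z => ?_) n x
  · refine hP.real_firstStep_of_consPath h0 measurableSet_hasDownSteps ?_ ?_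
    · exact fun n x => .of_forall fun ω hω => hasDownSteps_consPath_up hω n
    · exact fun n x => .of_forall fun ω hω => hasDownSteps_consPath_down hω n
  · simp [hasDownSteps_zero]

lemma measurableSet_le_downPos (w : ℤ) (n : ℕ) : MeasurableSet {ω | w ≤ downPos ω n} :=
  measurableSet_le measurable_const (measurable_downPos n)

lemma measurableSet_le_downPos_sub (b : ℤ) (m n : ℕ) :
    MeasurableSet {ω | b ≤ downPos ω (n + m) - downPos ω n} :=
  measurableSet_le measurable_const ((measurable_downPos _).sub (measurable_downPos _))

lemma IsUrnChain.real_le_downPos (h0 : 0 < lam) (h1 : lam < 1) (hP : IsUrnChain lam P) (w : ℤ)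
    (n : ℕ) (x : ℤ) :
    (P x).real {ω | w ≤ downPos ω n} = raceProb lam w n (w + n - x).toNat := by
  have := hP.1
  refine eq_of_firstStep h0 h1 (Φ := fun n x => (P x).real {ω | w ≤ downPos ω n})
    (Ψ := fun n x => raceProb lam w n (w + n - x).toNat)
    (fun n x => ⟨measureReal_nonneg, measureReal_le_one⟩)
    (fun n x => raceProb_mem_Icc h0 w n _) ?_ (raceProb_firstStep w) (fun x => ?_) n x
  · refine hP.real_firstStep_of_consPath h0 (measurableSet_le_downPos w) ?_ ?_
    · intro n x
      filter_upwards [hP.ae_hasDownSteps h0 h1 (n + 1) (x + 1)] with ω h hω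
      simp only [downPos_consPath_up hω h]
    · intro n x
      filter_upwards [hP.ae_hasDownSteps h0 h1 n (x - 1)] with ω h hω
      simp only [downPos_consPath_down hω h]
  · have hcongr : (P x).real {ω | w ≤ downPos ω 0} = (P x).real {_ω | w ≤ x} := by
      refine measureReal_congr ?_
      filter_upwards [hP.ae_start x] with ω hω
      refine propext ?_
      change w ≤ downPos ω 0 ↔ w ≤ x
      rw [downPos_zero, hω]
    rw [hcongr]
    by_cases hw : w ≤ x
    · rw [Nat.cast_zero, add_zero, Int.toNat_of_nonpos (by omega)]
      simp [hw, raceProb_zero_right]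
    · obtain ⟨k, hk⟩ := Nat.exists_eq_succ_of_ne_zero
        (show (w + (0 : ℕ) - x).toNat ≠ 0 by simp; omega)
      rw [hk, raceProb_zero_left]
      simp [hw]

lemma IsUrnChain.real_le_downPos_sub_firstStep (h0 : 0 < lam) (h1 : lam < 1)
    (hP : IsUrnChain lam P) (b : ℤ) (m n : ℕ) (x : ℤ) :
    (P x).real {ω | b ≤ downPos ω (n + 1 + m) - downPos ω (n + 1)} =
      upProb lam x * (P (x + 1)).real {ω | b ≤ downPos ω (n + 1 + m) - downPos ω (n + 1)} +
        (1 - upProb lam x) * (P (x - 1)).real {ω | b ≤ downPos ω (n + m) - downPos ω n} := by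
  refine hP.real_firstStep_of_consPath h0 (measurableSet_le_downPos_sub b m) ?_ ?_ n x
  · intro n x
    filter_upwards [hP.ae_hasDownSteps h0 h1 (n + 1) (x + 1),
      hP.ae_hasDownSteps h0 h1 (n + m + 1) (x + 1)] with ω h h' hω
    simp only [add_right_comm n 1 m, downPos_consPath_up hω h,
      downPos_consPath_up hω h']
  · intro n x
    filter_upwards [hP.ae_hasDownSteps h0 h1 n (x - 1),
      hP.ae_hasDownSteps h0 h1 (n + m) (x - 1)] with ω h h' hω
    simp only [add_right_comm n 1 m, downPos_consPath_down hω h,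
      downPos_consPath_down hω h']

lemma IsUrnChain.real_le_downPos_sub_zero (h0 : 0 < lam) (h1 : lam < 1)
    (hP : IsUrnChain lam P) (b m : ℕ) (x : ℤ) :
    (P x).real {ω | (b : ℤ) ≤ downPos ω (0 + m) - downPos ω 0} =
      raceProb lam (x + b) m (b + m) := by
  have hcongr : (P x).real {ω | (b : ℤ) ≤ downPos ω (0 + m) - downPos ω 0} =
      (P x).real {ω | x + b ≤ downPos ω m} := by
    refine measureReal_congr ?_
    filter_upwards [hP.ae_start x] with ω hω
    refine propext ?_
    change (b : ℤ) ≤ downPos ω (0 + m) - downPos ω 0 ↔ x + b ≤ downPos ω m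
    rw [downPos_zero, hω, zero_add, le_sub_iff_add_le, add_comm]
  rw [hcongr, hP.real_le_downPos h0 h1, show x + b + m - x = ((b + m : ℕ) : ℤ) by push_cast; ring,
    Int.toNat_natCast]

/-- The lower tail of the position at the `n`-th down-step, for the chain started at `x`. -/
def lowerTail (lam : ℝ) (v : ℤ) (n : ℕ) (x : ℤ) : ℝ :=
  1 - raceProb lam (v + 1) n (v + 1 + n - x).toNat

lemma lowerTail_mem_Icc (h0 : 0 < lam) (v : ℤ) (n : ℕ) (x : ℤ) :
    lowerTail lam v n x ∈ Set.Icc (0 : ℝ) 1 := by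
  have := raceProb_mem_Icc h0 (v + 1) n (v + 1 + n - x).toNat
  exact ⟨sub_nonneg.2 this.2, sub_le_self _ this.1⟩

lemma lowerTail_firstStep (v : ℤ) (n : ℕ) (x : ℤ) :
    lowerTail lam v (n + 1) x = upProb lam x * lowerTail lam v (n + 1) (x + 1) +
      (1 - upProb lam x) * lowerTail lam v n (x - 1) := by
  unfold lowerTail
  rw [raceProb_firstStep]
  ring

lemma lowerTail_zero (v x : ℤ) : lowerTail lam v 0 x = if x ≤ v then 1 else 0 := by
  unfold lowerTail
  split_ifs with h
  · obtain ⟨k, hk⟩ := Nat.exists_eq_succ_of_ne_zero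
      (show (v + 1 + (0 : ℕ) - x).toNat ≠ 0 by simp; omega)
    rw [hk, raceProb_zero_left, sub_zero]
  · rw [Int.toNat_of_nonpos (by push_cast; omega), raceProb_zero_right, sub_self]

lemma lowerTail_pred_le (h0 : 0 < lam) (h1 : lam < 1) {v : ℤ} (hv : v ≤ 0) {n : ℕ} (hn : 1 ≤ n)
    (x : ℤ) : lowerTail lam (v - 1) n x ≤ raceRatio lam * lowerTail lam v n x := by
  rcases le_or_gt (v + n - x) 0 with h | h
  · rw [lowerTail, Int.toNat_of_nonpos (by omega), raceProb_zero_right, sub_self]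
    exact mul_nonneg (raceRatio_mem_Ioo h0 h1).1.le (lowerTail_mem_Icc h0 v n x).1
  · obtain ⟨U, hU⟩ := Int.eq_ofNat_of_zero_le h.le
    obtain ⟨k, rfl⟩ := Nat.exists_eq_succ_of_ne_zero (show n ≠ 0 by omega)
    have e1 := raceProb_add_reflect h0 v (k + 1) U (by omega)
    have e2 := raceProb_add_reflect h0 (v + 1) (k + 1) (U + 1) (by omega)
    have e3 := raceProb_le_succ_left h0 (-v + 1) U (k + 1)
    have e4 := raceProb_level_succ_le_ratio h0 h1 (w := -v) (by omega) (U + 1) k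
    rw [show (1 : ℤ) - v = -v + 1 by ring] at e1
    rw [show (1 : ℤ) - (v + 1) = -v by ring] at e2
    unfold lowerTail
    rw [show v - 1 + 1 + (k + 1 : ℕ) - x = (U : ℤ) by omega,
      show v + 1 + (k + 1 : ℕ) - x = ((U + 1 : ℕ) : ℤ) by push_cast at hU ⊢; omega,
      Int.toNat_natCast, Int.toNat_natCast, sub_add_cancel, ← eq_sub_of_add_eq' e1,
      ← eq_sub_of_add_eq' e2]
    exact e3.trans e4

lemma lowerTail_sub_le (h0 : 0 < lam) (h1 : lam < 1) {v : ℤ} (hv : v ≤ 0) {n : ℕ} (hn : 1 ≤ n)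
    (x : ℤ) (k : ℕ) : lowerTail lam (v - k) n x ≤ raceRatio lam ^ k * lowerTail lam v n x := by
  induction k with
  | zero => simp
  | succ k ih =>
    rw [show v - ((k + 1 : ℕ) : ℤ) = v - k - 1 by push_cast; ring, pow_succ', mul_assoc]
    exact (lowerTail_pred_le h0 h1 (by omega) hn x).trans
      (mul_le_mul_of_nonneg_left ih (raceRatio_mem_Ioo h0 h1).1.le)

/-- A large increment costs a geometric factor, unless the chain starts it far below zero. -/
lemma IsUrnChain.real_le_downPos_sub_add_le (h0 : 0 < lam) (h1 : lam < 1)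
    (hP : IsUrnChain lam P) {b m : ℕ} (hb : 1 ≤ b) (h k n : ℕ) (x : ℤ) :
    (P x).real {ω | ((b + h + k : ℕ) : ℤ) ≤ downPos ω (n + m) - downPos ω n} ≤
      raceRatio lam ^ k * (P x).real {ω | (b : ℤ) ≤ downPos ω (n + m) - downPos ω n} +
        lowerTail lam (-(b : ℤ) - 1 - h) n x := by
  have := hP.1
  have hr := (raceRatio_mem_Ioo h0 h1).1.le
  refine sub_nonneg.1 (nonneg_of_firstStep (M := 1) (Ψ := fun n x =>
      raceRatio lam ^ k * (P x).real {ω | (b : ℤ) ≤ downPos ω (n + m) - downPos ω n} +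
        lowerTail lam (-(b : ℤ) - 1 - h) n x -
      (P x).real {ω | ((b + h + k : ℕ) : ℤ) ≤ downPos ω (n + m) - downPos ω n}) h0 h1
    (fun n x => ?_) (fun n x => ?_) (fun x => ?_) n x)
  · have e1 : (P x).real {ω | ((b + h + k : ℕ) : ℤ) ≤ downPos ω (n + m) - downPos ω n} ≤ 1 :=
      measureReal_le_one
    have e2 := (lowerTail_mem_Icc h0 (-(b : ℤ) - 1 - h) n x).1
    have e3 : 0 ≤ raceRatio lam ^ k *
      (P x).real {ω | (b : ℤ) ≤ downPos ω (n + m) - downPos ω n} := by positivity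
    linarith
  · rw [hP.real_le_downPos_sub_firstStep h0 h1 b, lowerTail_firstStep,
      hP.real_le_downPos_sub_firstStep h0 h1 (b + h + k : ℕ)]
    ring
  · rw [sub_nonneg, hP.real_le_downPos_sub_zero h0 h1, hP.real_le_downPos_sub_zero h0 h1,
      lowerTail_zero]
    split_ifs with hx
    · have e1 := (raceProb_mem_Icc h0 (x + (b + h + k : ℕ)) m (b + h + k + m)).2
      have e2 := mul_nonneg (pow_nonneg hr k) (raceProb_mem_Icc h0 (x + b) m (b + m)).1
      linarith
    · obtain ⟨U, hU⟩ := Nat.exists_eq_succ_of_ne_zero (show b + m + h ≠ 0 by omega)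
      rw [add_zero, show x + ((b + h + k : ℕ) : ℤ) = x + b + h + k by push_cast; ring,
        show b + h + k + m = U + 1 + k by omega]
      refine (raceProb_level_add_le h0 h1 (by omega) m U k).trans
        (mul_le_mul_of_nonneg_left ?_ (pow_nonneg hr k))
      have := raceProb_level_add_le_self h0 h1 (x + b) m (b + m) h
      rwa [hU] at this

/-- If the chain is low enough at the `n`-th down-step, then an increment of size `b` has
probability bounded below. -/
lemma IsUrnChain.lowerTail_le (h0 : 0 < lam) (h1 : lam < 1)
    (hP : IsUrnChain lam P) (b n : ℕ) {m : ℕ} (hm : 1 ≤ m) (x : ℤ) :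
    (1 - raceRatio lam) * lowerTail lam (-(b : ℤ) - 1) n x ≤
      (P x).real {ω | (b : ℤ) ≤ downPos ω (n + m) - downPos ω n} := by
  have := hP.1
  have hr := raceRatio_mem_Ioo h0 h1
  refine sub_nonneg.1 (nonneg_of_firstStep (M := 1) (Ψ := fun n x =>
      (P x).real {ω | (b : ℤ) ≤ downPos ω (n + m) - downPos ω n} -
      (1 - raceRatio lam) * lowerTail lam (-(b : ℤ) - 1) n x) h0 h1
    (fun n x => ?_) (fun n x => ?_) (fun x => ?_) n x)
  · have e1 : 0 ≤ (P x).real {ω | (b : ℤ) ≤ downPos ω (n + m) - downPos ω n} :=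
      measureReal_nonneg
    have e2 := lowerTail_mem_Icc h0 (-(b : ℤ) - 1) n x
    nlinarith [e2.1, e2.2, hr.1, hr.2]
  · rw [hP.real_le_downPos_sub_firstStep h0 h1 b, lowerTail_firstStep]
    ring
  · rw [sub_nonneg, hP.real_le_downPos_sub_zero h0 h1, lowerTail_zero]
    split_ifs with hx
    · obtain ⟨l, rfl⟩ := Nat.exists_eq_succ_of_ne_zero (show m ≠ 0 by omega)
      rw [mul_one]
      exact one_sub_ratio_le_raceProb h0 h1 (by omega) l _
    · rw [mul_zero]
      exact (raceProb_mem_Icc h0 _ _ _).1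

/-- Geometric overshoot bound for the increments of the chain at down-step times. -/
lemma IsUrnChain.real_le_downPos_sub_add_le_pow (h0 : 0 < lam) (h1 : lam < 1)
    (hP : IsUrnChain lam P) {b n m : ℕ} (hb : 1 ≤ b) (hn : 1 ≤ n) (hm : 1 ≤ m) (h k : ℕ)
    (hk : h ≤ k) (x : ℤ) :
    (P x).real {ω | ((b + h + k : ℕ) : ℤ) ≤ downPos ω (n + m) - downPos ω n} ≤
      (1 + (1 - raceRatio lam)⁻¹) * raceRatio lam ^ h *
        (P x).real {ω | (b : ℤ) ≤ downPos ω (n + m) - downPos ω n} := by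
  have hr := raceRatio_mem_Ioo h0 h1
  have e1 := hP.real_le_downPos_sub_add_le (m := m) h0 h1 hb h k n x
  have e2 := lowerTail_sub_le h0 h1 (v := -(b : ℤ) - 1) (by omega) hn x h
  have e3 := hP.lowerTail_le h0 h1 b n hm x
  have e4 : raceRatio lam ^ k ≤ raceRatio lam ^ h := pow_le_pow_of_le_one hr.1.le hr.2.le hk
  rw [← le_inv_mul_iff₀ (sub_pos.2 hr.2)] at e3
  have hS : 0 ≤ (P x).real {ω | (b : ℤ) ≤ downPos ω (n + m) - downPos ω n} := measureReal_nonneg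
  have e5 := mul_le_mul_of_nonneg_right e4 hS
  have e6 := mul_le_mul_of_nonneg_left e3 (pow_nonneg hr.1.le h)
  linarith

end ChainAtDownSteps

/-- Exponential overshoot bound for the increment `𝔇_{β_{n+m}} - 𝔇_{β_n}`. -/
theorem urn_increment_overshoot (lam : ℝ) (hlam : lam ∈ Set.Ioo (0 : ℝ) 1)
    (P : ℤ → Measure (ℕ → ℤ)) (hP : IsUrnChain lam P) :
    ∃ C > (0 : ℝ), ∃ c > (0 : ℝ),
      ∀ (b n m x : ℕ), 1 ≤ b → 1 ≤ n → 1 ≤ m → 1 ≤ x → ∀ i : ℤ, i = 0 ∨ i = 1 →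
        (P i {ω | (b : ℤ) + (x : ℤ) ≤
            ω (betaTime ω (n + m)) - ω (betaTime ω n)}).toReal ≤
          C * Real.exp (-c * (x : ℝ)) *
            (P i {ω | (b : ℤ) ≤ ω (betaTime ω (n + m)) - ω (betaTime ω n)}).toReal := by
  obtain ⟨h0, h1⟩ := hlam
  have hr := raceRatio_mem_Ioo h0 h1
  have hlog : Real.log (raceRatio lam) < 0 := Real.log_neg hr.1 hr.2
  have hC : 0 < 1 + (1 - raceRatio lam)⁻¹ := by
    have := inv_pos.2 (sub_pos.2 hr.2)
    linarith
  refine ⟨(1 + (1 - raceRatio lam)⁻¹) * (raceRatio lam)⁻¹, mul_pos hC (inv_pos.2 hr.1),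
    -(Real.log (raceRatio lam)) / 2, by linarith, ?_⟩
  intro b n m x hb hn hm _ i _
  simp only [betaTime_eq_downTime _ hn, betaTime_eq_downTime _ (hn.trans (Nat.le_add_right n m))]
  have hx : ((b + x / 2 + (x - x / 2) : ℕ) : ℤ) = (b : ℤ) + (x : ℤ) := by omega
  have hmain := hP.real_le_downPos_sub_add_le_pow h0 h1 hb hn hm (x / 2) (x - x / 2)
    (by omega) i
  rw [hx] at hmain
  refine hmain.trans (mul_le_mul_of_nonneg_right ?_ ENNReal.toReal_nonneg)
  rw [mul_assoc]
  refine mul_le_mul_of_nonneg_left ?_ hC.le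
  have hx2 : (x : ℝ) / 2 - 1 ≤ ((x / 2 : ℕ) : ℝ) := by
    have : x ≤ 2 * (x / 2) + 1 := by omega
    have : (x : ℝ) ≤ 2 * ((x / 2 : ℕ) : ℝ) + 1 := by exact_mod_cast this
    linarith
  have hexp : raceRatio lam ^ (x / 2) = Real.exp (Real.log (raceRatio lam) * (x / 2 : ℕ)) := by
    rw [mul_comm, Real.exp_nat_mul, Real.exp_log hr.1]
  have hinv : (raceRatio lam)⁻¹ = Real.exp (-Real.log (raceRatio lam)) := by
    rw [Real.exp_neg, Real.exp_log hr.1]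
  rw [hexp, hinv, ← Real.exp_add, Real.exp_le_exp]
  nlinarith [mul_le_mul_of_nonpos_left hx2 hlog.le]
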